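/- Let 𝒜 be an abelian category, 𝒳 a full subcategory of 𝒜 closed under extensions, and 𝒢 a full subcategory of 𝒳 that is a generator for 𝒳, meaning that for every object X of 𝒳 there exists a short exact sequence 0 → X' → G → X → 0 with G in 𝒢 and X' in 𝒳. If an object M of 𝒜 admits an exact sequence ⋯ → G_n → ⋯ → G_1 → G_0 → M → 0 with every G_i in 𝒳, then M admits an exact sequence ⋯ → P_n → ⋯ → P_1 → P_0 → M → 0 with every P_i in 𝒢. -/

import Mathlib

open CategoryTheory Limits

universe w v u

noncomputable section

/-- An exact sequence `⋯ → X 1 → X 0 → target` all of whose terms except possibly the target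
satisfy `𝒳`. The augmentation is not required to be an epimorphism. -/
structure AugmentedExactSeq {𝒜 : Type u} [Category.{v} 𝒜] [Abelian 𝒜] (𝒳 : 𝒜 → Prop) where
  /-- the object on the right -/
  target : 𝒜
  /-- the terms of the sequence -/
  X : ℕ → 𝒜
  /-- the differentials -/
  d : ∀ n, X (n + 1) ⟶ X n
  /-- the augmentation -/
  ε : X 0 ⟶ target
  prop : ∀ n, 𝒳 (X n)
  d_comp_ε : d 0 ≫ ε = 0
  exact_ε : (ShortComplex.mk (d 0) ε d_comp_ε).Exact
  d_comp_d : ∀ n, d (n + 1) ≫ d n = 0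
  exact_d : ∀ n, (ShortComplex.mk (d (n + 1)) (d n) (d_comp_d n)).Exact

section PullbackExactness

variable {𝒜 : Type u} [Category.{v} 𝒜] [Abelian 𝒜]

/-- The base change of a short exact sequence along a morphism to its right-hand object. -/
lemma shortExact_pullback_fst {Y' G Y Z : 𝒜} {i : Y' ⟶ G} {p : G ⟶ Y} {w : i ≫ p = 0}
    (h : (ShortComplex.mk i p w).ShortExact) (b : Z ⟶ Y) :
    (ShortComplex.mk (pullback.lift (f := b) (g := p) 0 i (by simp [w])) (pullback.fst b p)
      (pullback.lift_fst _ _ _)).ShortExact := by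
  have := h.mono_f
  have := h.epi_g
  dsimp at *
  refine { exact := ?_, mono_f := ?_, epi_g := by dsimp; infer_instance }
  · rw [ShortComplex.exact_iff_exact_up_to_refinements]
    intro A x hx
    dsimp at x hx
    obtain ⟨A', π, hπ, y, hy⟩ := h.exact.exact_up_to_refinements (x ≫ pullback.snd b p)
      (by dsimp; rw [Category.assoc, ← pullback.condition, reassoc_of% hx, zero_comp])
    refine ⟨A', π, hπ, y, ?_⟩
    apply pullback.hom_ext
    · simp [hx, pullback.lift_fst]
    · simpa [pullback.lift_snd] using hy
  · dsimp
    exact mono_of_mono_fac (pullback.lift_snd (f := b) (g := p) 0 i _)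

/-- Exactness in the middle is preserved by pulling back along any morphism to the middle
object. -/
lemma exact_pullback_snd {A B C G : 𝒜} {a : A ⟶ B} {b : B ⟶ C} {w : a ≫ b = 0}
    (h : (ShortComplex.mk a b w).Exact) (p : G ⟶ B) :
    (ShortComplex.mk (pullback.snd a p) (p ≫ b)
      (by rw [← pullback.condition_assoc, w, comp_zero])).Exact := by
  rw [ShortComplex.exact_iff_exact_up_to_refinements]
  intro T x hx
  dsimp at x hx
  obtain ⟨T', π, hπ, y, hy⟩ := h.exact_up_to_refinements (x ≫ p) (by simpa using hx)
  dsimp at y hy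
  exact ⟨T', π, hπ, pullback.lift y (π ≫ x) (by simpa using hy.symm),
    (pullback.lift_snd _ _ _).symm⟩

/-- If `A ⟶ B ⟶ C` is exact, then so is `A ⟶ B ×[C] G ⟶ G`. -/
lemma exact_pullback_lift_zero {A B C G : 𝒜} {a : A ⟶ B} {b : B ⟶ C} {w : a ≫ b = 0}
    (h : (ShortComplex.mk a b w).Exact) (p : G ⟶ C) :
    (ShortComplex.mk (pullback.lift (f := b) (g := p) a 0 (by simp [w])) (pullback.snd b p)
      (pullback.lift_snd _ _ _)).Exact := by
  rw [ShortComplex.exact_iff_exact_up_to_refinements]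
  intro T x hx
  dsimp at x hx
  obtain ⟨T', π, hπ, y, hy⟩ := h.exact_up_to_refinements (x ≫ pullback.fst b p)
    (by dsimp; rw [Category.assoc, pullback.condition, reassoc_of% hx, zero_comp])
  refine ⟨T', π, hπ, y, ?_⟩
  apply pullback.hom_ext
  · simpa [pullback.lift_fst] using hy
  · simp [hx, pullback.lift_snd]

/-- If `A ⟶ B ⟶ D` is exact, where `B ⟶ D` factors through `C` and `A ⟶ B ⟶ C` is zero, then
`A ⟶ B ⟶ C` is exact. -/
lemma exact_of_exact_comp {A B C D : 𝒜} {a : A ⟶ B} {b : B ⟶ C} {c : C ⟶ D}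
    {w : a ≫ b = 0} {w' : a ≫ b ≫ c = 0} (h : (ShortComplex.mk a (b ≫ c) w').Exact) :
    (ShortComplex.mk a b w).Exact := by
  rw [ShortComplex.exact_iff_exact_up_to_refinements]
  intro T x hx
  dsimp at x hx
  exact h.exact_up_to_refinements x (by simp [reassoc_of% hx])

end PullbackExactness

/-- Cover `X 0` by an object `G` of the generator: then `G ⟶ target` extends to the left by an
exact sequence with terms satisfying `𝒳`, now augmented towards `G`. -/
lemma AugmentedExactSeq.exists_cover
    {𝒜 : Type u} [Category.{v} 𝒜] [Abelian 𝒜] {𝒳 𝒢 : 𝒜 → Prop}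
    (h𝒳ext : ∀ (A B D : 𝒜) (f : A ⟶ B) (g : B ⟶ D) (w : f ≫ g = 0),
      (ShortComplex.mk f g w).ShortExact → 𝒳 A → 𝒳 D → 𝒳 B)
    (h𝒢gen : ∀ Y : 𝒜, 𝒳 Y → ∃ (Y' G : 𝒜) (f : Y' ⟶ G) (g : G ⟶ Y) (w : f ≫ g = 0),
      (ShortComplex.mk f g w).ShortExact ∧ 𝒢 G ∧ 𝒳 Y')
    (S : AugmentedExactSeq 𝒳) :
    ∃ (T : AugmentedExactSeq 𝒳) (p : T.target ⟶ S.X 0) (w : T.ε ≫ p ≫ S.ε = 0),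
      𝒢 T.target ∧ Epi p ∧ (ShortComplex.mk T.ε (p ≫ S.ε) w).Exact := by
  obtain ⟨Y', G, i, p, w, hs, hG, hY'⟩ := h𝒢gen (S.X 0) (S.prop 0)
  have hQ : 𝒳 (pullback (S.d 0) p) :=
    h𝒳ext _ _ _ _ _ _ (shortExact_pullback_fst hs (S.d 0)) hY' (S.prop 1)
  let l : S.X 2 ⟶ pullback (S.d 0) p := pullback.lift (S.d 1) 0 (by simp [S.d_comp_d 0])
  have hl : l ≫ pullback.fst (S.d 0) p = S.d 1 := pullback.lift_fst _ _ _
  have wl : S.d 2 ≫ l = 0 := by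
    apply pullback.hom_ext
    · simp [hl, S.d_comp_d 1]
    · simp [l, pullback.lift_snd]
  refine ⟨{ target := G
            X := fun n => Nat.casesOn n (pullback (S.d 0) p) fun n => S.X (n + 2)
            d := fun n => Nat.casesOn n l fun n => S.d (n + 2)
            ε := pullback.snd (S.d 0) p
            prop := fun n => Nat.casesOn n hQ fun n => S.prop (n + 2)
            d_comp_ε := pullback.lift_snd _ _ _
            exact_ε := exact_pullback_lift_zero (S.exact_d 0) p
            d_comp_d := fun n => Nat.casesOn n wl fun n => S.d_comp_d (n + 2)
            exact_d := ?_ }, p, _, hG, hs.epi_g, exact_pullback_snd S.exact_ε p⟩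
  rintro (_ | n)
  · have h : (ShortComplex.mk (S.d 2) (l ≫ pullback.fst (S.d 0) p)
        (by rw [reassoc_of% wl, zero_comp])).Exact := by
      simpa only [hl] using S.exact_d 1
    exact exact_of_exact_comp (w := wl) h
  · exact S.exact_d (n + 2)

/-- Let `𝒜` be an abelian category, `𝒳` a full subcategory closed under
isomorphisms and extensions, and `𝒢 ⊆ 𝒳` a generator for `𝒳`: for every object `X` of `𝒳`
there is a short exact sequence `0 → X' → G → X → 0` with `G` in `𝒢` and `X'` in `𝒳`.
If `M` admits an exact sequence `⋯ → G_1 → G_0 → M → 0` with all `G_i` in `𝒳`, then `M`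
admits an exact sequence `⋯ → P_1 → P_0 → M → 0` with all `P_i` in `𝒢`. -/
theorem resolution_by_generator_of_resolution
    {𝒜 : Type u} [Category.{v} 𝒜] [Abelian 𝒜]
    (𝒳 𝒢 : 𝒜 → Prop)
    (h𝒳iso : ∀ {A B : 𝒜}, (A ≅ B) → 𝒳 A → 𝒳 B)
    (h𝒢iso : ∀ {A B : 𝒜}, (A ≅ B) → 𝒢 A → 𝒢 B)
    (h𝒢𝒳 : ∀ A : 𝒜, 𝒢 A → 𝒳 A)
    -- `𝒳` is closed under extensions
    (h𝒳ext : ∀ (A B D : 𝒜) (f : A ⟶ B) (g : B ⟶ D) (w : f ≫ g = 0),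
      (ShortComplex.mk f g w).ShortExact → 𝒳 A → 𝒳 D → 𝒳 B)
    -- `𝒢` is a generator for `𝒳`
    (h𝒢gen : ∀ Y : 𝒜, 𝒳 Y → ∃ (Y' G : 𝒜) (f : Y' ⟶ G) (g : G ⟶ Y) (w : f ≫ g = 0),
      (ShortComplex.mk f g w).ShortExact ∧ 𝒢 G ∧ 𝒳 Y')
    -- an exact sequence `⋯ → G_1 → G_0 → M → 0` with all `G_i` in `𝒳`
    (M : 𝒜) (X : ℕ → 𝒜) (d : ∀ n, X (n + 1) ⟶ X n) (ε : X 0 ⟶ M)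
    (hX : ∀ n, 𝒳 (X n)) (hε : Epi ε) (w₀ : d 0 ≫ ε = 0)
    (hex₀ : (ShortComplex.mk (d 0) ε w₀).Exact)
    (wd : ∀ n, d (n + 1) ≫ d n = 0)
    (hexd : ∀ n, (ShortComplex.mk (d (n + 1)) (d n) (wd n)).Exact) :
    -- an exact sequence `⋯ → P_1 → P_0 → M → 0` with all `P_i` in `𝒢`
    ∃ (P : ℕ → 𝒜) (d' : ∀ n, P (n + 1) ⟶ P n) (ε' : P 0 ⟶ M)
      (w₀' : d' 0 ≫ ε' = 0) (wd' : ∀ n, d' (n + 1) ≫ d' n = 0),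
      (∀ n, 𝒢 (P n)) ∧ Epi ε' ∧ (ShortComplex.mk (d' 0) ε' w₀').Exact ∧
        ∀ n, (ShortComplex.mk (d' (n + 1)) (d' n) (wd' n)).Exact := by
  let S₀ : AugmentedExactSeq 𝒳 := ⟨M, X, d, ε, hX, w₀, hex₀, wd, hexd⟩
  choose next p w hG hp hex using
    fun S : AugmentedExactSeq 𝒳 => S.exists_cover h𝒳ext h𝒢gen
  let S : ℕ → AugmentedExactSeq 𝒳 := fun n => Nat.rec S₀ (fun _ T => next T) n
  let e : ∀ n, (S (n + 1)).target ⟶ (S n).target := fun n => p (S n) ≫ (S n).ε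
  have we : ∀ n, e (n + 1) ≫ e n = 0 := fun n => by
    have h := w (S n)
    change (p (next (S n)) ≫ (next (S n)).ε) ≫ p (S n) ≫ (S n).ε = 0
    rw [Category.assoc, h, comp_zero]
  have hexe : ∀ n, (ShortComplex.mk (e (n + 1)) (e n) (we n)).Exact := fun n => by
    rw [ShortComplex.exact_iff_exact_up_to_refinements]
    intro A x hx
    obtain ⟨A', π, hπ, y, hy⟩ := (hex (S n)).exact_up_to_refinements x hx
    have := hp (next (S n))
    obtain ⟨A'', π', hπ', z, hz⟩ := surjective_up_to_refinements_of_epi (p (next (S n))) y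
    refine ⟨A'', π' ≫ π, epi_comp _ _, z, ?_⟩
    change (π' ≫ π) ≫ x = z ≫ p (next (S n)) ≫ (next (S n)).ε
    rw [Category.assoc, hy, reassoc_of% hz]
  have := hp S₀
  exact ⟨fun n => (S (n + 1)).target, fun n => e (n + 1), e 0, we 0, fun n => we (n + 1),
    fun n => hG (S n), epi_comp (p S₀) ε, hexe 0, fun n => hexe (n + 1)⟩
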